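/- Let q ≥ 2 and M be positive integers, let S_1,…,S_M be independent random variables taking values in {0,…,q−1}, and let θ_0,…,θ_{q−1} be nonnegative integers. For each ℓ ∈ {0,…,q−1} and each partition of [1:M] into nonempty pairwise disjoint sets A^{(ℓ)}_1,…,A^{(ℓ)}_{J_ℓ} with union [1:M], define U^{(ℓ)}_0 = 0 and U^{(ℓ)}_m = U^{(ℓ)}_{m−1} + ∑_{i∈A^{(ℓ)}_m} 1{U^{(ℓ)}_{m−1} < θ_ℓ}·1{S_i = ℓ} for m ∈ [1:J_ℓ]. Then there exist q such partitions (one for each ℓ) for which the joint Shannon entropy (in bits) of all descriptions satisfies H( U^{(0)}_{[1:J_0]}, U^{(1)}_{[1:J_1]}, …, U^{(q−1)}_{[1:J_{q−1}]} ) ≤ 12q + (5/2)·∑_{ℓ=0}^{q−1} log₂(1+θ_ℓ). -/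

import Mathlib

open MeasureTheory ProbabilityTheory

/-- Shannon entropy (in bits) of a random variable `X` with respect to the measure `μ`:
`H(X) = -∑ₐ P(X = a) log₂ P(X = a)`, with the convention `0 · log₂ 0 = 0`. -/
noncomputable def shannonEntropy {Ω α : Type*} [MeasurableSpace Ω]
    (μ : Measure Ω) (X : Ω → α) : ℝ :=
  ∑' a : α, -((μ (X ⁻¹' {a})).toReal * Real.logb 2 (μ (X ⁻¹' {a})).toReal)

/-- The descriptions of the clipped frequency of the value `ℓ`:
`U₀ = 0` and `U_m = U_{m-1} + ∑_{i ∈ A_m} 1{U_{m-1} < θ} · 1{S i = ℓ}`. -/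
def descr {Ω : Type*} {M : ℕ} (S : Fin M → Ω → ℕ) (ℓ θ : ℕ)
    (A : ℕ → Finset (Fin M)) : ℕ → Ω → ℕ
  | 0, _ => 0
  | m + 1, ω =>
      descr S ℓ θ A m ω +
        if descr S ℓ θ A m ω < θ then ((A (m + 1)).filter fun i => S i ω = ℓ).card else 0

/-- Gibbs' inequality: the entropy is at most the mean code length of any subprobability. -/
theorem shannonEntropy_le_integral_neg_logb {Ω α : Type*} [MeasurableSpace Ω]
    (μ : Measure Ω) [IsProbabilityMeasure μ] (X : Ω → α) (F : Finset α) (hXF : ∀ ω, X ω ∈ F)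
    (hX : ∀ a, MeasurableSet (X ⁻¹' {a})) (Q : α → ℝ) (hQ₀ : ∀ a, 0 ≤ Q a)
    (hQX : ∀ ω, 0 < Q (X ω)) (hQ : ∑ a ∈ F, Q a ≤ 1) :
    shannonEntropy μ X ≤ ∫ ω, -Real.logb 2 (Q (X ω)) ∂μ := by
  classical
  have expand (h : α → ℝ) :
      ∫ ω, h (X ω) ∂μ = ∑ a ∈ F, μ.real (X ⁻¹' {a}) * h a := by
    have hpt : ∀ ω, h (X ω) = ∑ a ∈ F, (X ⁻¹' {a}).indicator (fun _ => h a) ω := by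
      intro ω
      rw [Finset.sum_eq_single (X ω)]
      · simp
      · intro b _ hb
        simp [Ne.symm hb]
      · intro hn
        exact absurd (hXF ω) hn
    simp_rw [hpt]
    rw [integral_finsetSum]
    · refine Finset.sum_congr rfl fun a _ => ?_
      rw [integral_indicator_const _ (hX a), smul_eq_mul]
    · exact fun a _ => (integrable_const _).indicator (hX a)
  have htotal : ∑ a ∈ F, μ.real (X ⁻¹' {a}) = 1 := by
    have := expand (fun _ => 1)
    simpa using this.symm
  have hent : shannonEntropy μ X =
      ∑ a ∈ F, -(μ.real (X ⁻¹' {a}) * Real.logb 2 (μ.real (X ⁻¹' {a}))) := by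
    refine tsum_eq_sum fun a ha => ?_
    have : X ⁻¹' {a} = ∅ := by
      ext ω
      simp only [Set.mem_preimage, Set.mem_singleton_iff, Set.mem_empty_iff_false, iff_false]
      rintro rfl
      exact ha (hXF ω)
    simp [this]
  have hterm : ∀ a ∈ F, -(μ.real (X ⁻¹' {a}) * Real.logb 2 (μ.real (X ⁻¹' {a}))) ≤
      μ.real (X ⁻¹' {a}) * -Real.logb 2 (Q a) +
        (Q a - μ.real (X ⁻¹' {a})) / Real.log 2 := by
    intro a _
    have hlog : 0 < Real.log 2 := Real.log_pos one_lt_two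
    rcases (measureReal_nonneg (μ := μ) (s := X ⁻¹' {a})).eq_or_lt with h0 | hpos
    · rw [← h0]
      have := div_nonneg (hQ₀ a) hlog.le
      simpa using this
    · have hQa : 0 < Q a := by
        obtain ⟨ω, rfl⟩ : (X ⁻¹' {a}).Nonempty := by
          by_contra hne
          rw [Set.not_nonempty_iff_eq_empty.1 hne] at hpos
          simp at hpos
        exact hQX ω
      set p := μ.real (X ⁻¹' {a})
      have h1 := Real.log_le_sub_one_of_pos (div_pos hQa hpos)
      rw [Real.log_div hQa.ne' hpos.ne'] at h1
      have h2 : p * (Real.log (Q a) - Real.log p) ≤ Q a - p := by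
        calc _ ≤ p * (Q a / p - 1) := by gcongr
          _ = Q a - p := by field_simp
      have h3 := div_le_div_of_nonneg_right h2 hlog.le
      simp only [Real.logb]
      have e : p * (Real.log (Q a) - Real.log p) / Real.log 2 =
        p * (Real.log (Q a) / Real.log 2) - p * (Real.log p / Real.log 2) := by ring
      linarith
  rw [hent, expand (fun a => -Real.logb 2 (Q a))]
  refine (Finset.sum_le_sum hterm).trans ?_
  rw [Finset.sum_add_distrib, ← Finset.sum_div, Finset.sum_sub_distrib, htotal]
  have : (∑ a ∈ F, Q a - 1) / Real.log 2 ≤ 0 :=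
    div_nonpos_of_nonpos_of_nonneg (by linarith) (Real.log_pos one_lt_two).le
  linarith

/-- Elements of weight at most `1` can be grouped so that every group has weight at most `w + 1`
and every group but the last has weight at least `w`. -/
theorem exists_balanced_grouping {ι : Type*} [DecidableEq ι] (p : ι → ℝ)
    (hp : ∀ i, p i ≤ 1) (w : ℝ) (hw : 0 ≤ w) (s : Finset ι) (hs : s.Nonempty) :
    ∃ (J : ℕ) (c : ι → ℕ), 0 < J ∧ (∀ i ∈ s, c i ∈ Finset.Icc 1 J) ∧
      (∀ m ∈ Finset.Icc 1 J, ∃ i ∈ s, c i = m) ∧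
      (∀ m, ∑ i ∈ s with c i = m, p i ≤ w + 1) ∧
      (∀ m ∈ Finset.Ico 1 J, w ≤ ∑ i ∈ s with c i = m, p i) := by
  induction hs using Finset.Nonempty.cons_induction with
  | singleton i =>
    refine ⟨1, fun _ => 1, one_pos, by simp, by simp, fun m => ?_, by simp⟩
    have := hp i
    by_cases h : 1 = m
    · simp [h]; linarith
    · simp [h]; linarith
  | cons i s hi _ ih =>
    obtain ⟨J, c, hJ, hc, hne, hub, hlb⟩ := ih
    have hupd (k m : ℕ) : ∑ j ∈ Finset.cons i s hi with Function.update c i k j = m, p j =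
        (if k = m then p i else 0) + ∑ j ∈ s with c j = m, p j := by
      rw [Finset.sum_filter, Finset.sum_cons, Finset.sum_filter, Function.update_self]
      congr 1
      refine Finset.sum_congr rfl fun j hj => ?_
      rw [Function.update_of_ne (by rintro rfl; exact hi hj)]
    have hcs (k : ℕ) : ∀ j ∈ s, Function.update c i k j = c j := fun j hj =>
      Function.update_of_ne (by rintro rfl; exact hi hj) _ _
    have hpi := hp i
    by_cases hlast : ∑ j ∈ s with c j = J, p j < w
    · refine ⟨J, Function.update c i J, hJ, ?_, ?_, fun m => ?_, fun m hm => ?_⟩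
      · intro j hj
        rcases Finset.mem_cons.1 hj with rfl | hj
        · simpa using Nat.succ_le_of_lt hJ
        · rw [hcs J j hj]; exact hc j hj
      · intro m hm
        obtain ⟨j, hj, rfl⟩ := hne m hm
        exact ⟨j, Finset.mem_cons_of_mem hj, hcs J j hj⟩
      · rw [hupd]
        split_ifs with h
        · subst h; linarith
        · linarith [hub m]
      · rw [hupd, if_neg (by have := Finset.mem_Ico.1 hm; omega), zero_add]
        exact hlb m hm
    · have hempty : ∑ j ∈ s with c j = J + 1, p j = 0 := by
        rw [Finset.filter_false_of_mem, Finset.sum_empty]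
        intro j hj h
        have := Finset.mem_Icc.1 (hc j hj)
        omega
      refine ⟨J + 1, Function.update c i (J + 1), J.succ_pos, ?_, ?_, fun m => ?_, fun m hm => ?_⟩
      · intro j hj
        rcases Finset.mem_cons.1 hj with rfl | hj
        · simp
        · rw [hcs _ j hj]
          have := Finset.mem_Icc.1 (hc j hj)
          exact Finset.mem_Icc.2 (by omega)
      · intro m hm
        rcases eq_or_ne m (J + 1) with rfl | h
        · exact ⟨i, Finset.mem_cons_self _ _, by simp⟩
        · obtain ⟨j, hj, rfl⟩ := hne m (by rw [Finset.mem_Icc] at hm ⊢; omega)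
          exact ⟨j, Finset.mem_cons_of_mem hj, hcs _ j hj⟩
      · rw [hupd]
        split_ifs with h
        · subst h; linarith
        · linarith [hub m]
      · have hm' := Finset.mem_Ico.1 hm
        rw [hupd, if_neg (by omega), zero_add]
        rcases eq_or_ne m J with rfl | h
        · exact not_lt.1 hlast
        · exact hlb m (Finset.mem_Ico.2 (by omega))

/-- The weight of the path `u, f 0, f 1, …` under the transition weights `g`. -/
def pathWeight (g : ℕ → ℕ → ℝ) : (J : ℕ) → ℕ → (Fin J → ℕ) → ℝ
  | 0, _, _ => 1
  | J + 1, u, f => g u (f 0) * pathWeight g J (f 0) (Fin.tail f)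

theorem pathWeight_nonneg {g : ℕ → ℕ → ℝ} (hg : ∀ u v, 0 ≤ g u v) :
    ∀ (J u : ℕ) (f : Fin J → ℕ), 0 ≤ pathWeight g J u f
  | 0, _, _ => zero_le_one
  | J + 1, _, _ => mul_nonneg (hg _ _) (pathWeight_nonneg hg J _ _)

theorem sum_pathWeight_le_one {g : ℕ → ℕ → ℝ} (hg : ∀ u v, 0 ≤ g u v) (K : ℕ)
    (hsum : ∀ u, ∑ v ∈ Finset.range K, g u v ≤ 1) (J u : ℕ) :
    ∑ f ∈ Fintype.piFinset (fun _ : Fin J => Finset.range K), pathWeight g J u f ≤ 1 := by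
  induction J generalizing u with
  | zero => simp [pathWeight]
  | succ J ih =>
    have hbij : ∑ f ∈ Fintype.piFinset (fun _ : Fin (J + 1) => Finset.range K),
          pathWeight g (J + 1) u f =
        ∑ x ∈ Finset.range K ×ˢ Fintype.piFinset (fun _ : Fin J => Finset.range K),
          g u x.1 * pathWeight g J x.1 x.2 := by
      refine Finset.sum_nbij' (fun f => (f 0, Fin.tail f))
        (fun x => (Fin.cons x.1 x.2 : Fin (J + 1) → ℕ)) ?_ ?_ ?_ ?_ ?_
      · intro f hf
        simp only [Fintype.mem_piFinset, Finset.mem_product] at hf ⊢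
        exact ⟨hf 0, fun j => hf j.succ⟩
      · intro x hx
        simp only [Fintype.mem_piFinset, Finset.mem_product] at hx ⊢
        intro j
        induction j using Fin.cases with
        | zero => exact hx.1
        | succ j => exact hx.2 j
      · intro f _
        exact Fin.cons_self_tail f
      · intro x _
        simp
      · intro f _
        rfl
    rw [hbij, Finset.sum_product]
    refine le_trans (Finset.sum_le_sum fun v _ => ?_) (hsum u)
    dsimp only
    rw [← Finset.mul_sum]
    exact mul_le_of_le_one_right (hg u v) (ih v)

theorem pathWeight_eq_prod (g : ℕ → ℕ → ℝ) (J : ℕ) (D : ℕ → ℕ) :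
    pathWeight g J (D 0) (fun m => D (m.1 + 1)) =
      ∏ m ∈ Finset.range J, g (D m) (D (m + 1)) := by
  induction J generalizing D with
  | zero => rfl
  | succ J ih =>
    rw [Finset.prod_range_succ', mul_comm]
    exact congrArg _ (ih fun m => D (m + 1))

/-- Transition weights of a walk with geometric increments of ratio `r`, stopped once it
reaches `θ`. -/
noncomputable def stoppedGeometric (θ : ℕ) (r : ℝ) (u v : ℕ) : ℝ :=
  if u < θ then if u ≤ v then (1 - r) * r ^ (v - u) else 0 else if v = u then 1 else 0

theorem stoppedGeometric_nonneg (θ : ℕ) {r : ℝ} (hr₀ : 0 ≤ r) (hr₁ : r ≤ 1) (u v : ℕ) :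
    0 ≤ stoppedGeometric θ r u v := by
  have := sub_nonneg.2 hr₁
  unfold stoppedGeometric
  split_ifs <;> positivity

theorem sum_stoppedGeometric_le_one (θ : ℕ) {r : ℝ} (hr₀ : 0 ≤ r) (hr₁ : r < 1) (K u : ℕ) :
    ∑ v ∈ Finset.range K, stoppedGeometric θ r u v ≤ 1 := by
  unfold stoppedGeometric
  split_ifs with hu
  · rw [← Finset.sum_filter]
    have hsub : (Finset.range K).filter (u ≤ ·) ⊆ (Finset.range K).image (u + ·) := by
      intro v hv
      simp only [Finset.mem_filter, Finset.mem_range, Finset.mem_image] at hv ⊢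
      exact ⟨v - u, by omega, by omega⟩
    calc _ ≤ ∑ v ∈ (Finset.range K).image (u + ·), (1 - r) * r ^ (v - u) :=
          Finset.sum_le_sum_of_subset_of_nonneg hsub fun v _ _ =>
            mul_nonneg (sub_nonneg.2 hr₁.le) (pow_nonneg hr₀ _)
      _ = (1 - r) * ∑ k ∈ Finset.range K, r ^ k := by
          rw [Finset.sum_image (by intro a _ b _ h; simpa using h), Finset.mul_sum]
          simp
      _ = 1 - r ^ K := mul_neg_geom_sum r K
      _ ≤ 1 := by linarith [pow_nonneg hr₀ K]
  · rw [Finset.sum_ite_eq']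
    split_ifs <;> norm_num

theorem measurable_descr {Ω : Type*} [MeasurableSpace Ω] {M : ℕ} {S : Fin M → Ω → ℕ}
    (hS : ∀ i, Measurable (S i)) (ℓ θ : ℕ) (A : ℕ → Finset (Fin M)) (m : ℕ) :
    Measurable (descr S ℓ θ A m) := by
  induction m with
  | zero => exact measurable_const
  | succ m ih =>
    have hcard : Measurable fun ω => ((A (m + 1)).filter fun i => S i ω = ℓ).card := by
      simp only [Finset.card_filter]
      exact Finset.measurable_sum _ fun i _ =>
        Measurable.ite (hS i (measurableSet_singleton ℓ)) measurable_const measurable_const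
    exact ih.add (Measurable.ite (ih measurableSet_Iio) hcard measurable_const)

theorem descr_le_mul {Ω : Type*} {M : ℕ} (S : Fin M → Ω → ℕ) (ℓ θ : ℕ)
    (A : ℕ → Finset (Fin M)) (m : ℕ) (ω : Ω) : descr S ℓ θ A m ω ≤ m * M := by
  induction m with
  | zero => simp [descr]
  | succ m ih =>
    have hcard : ((A (m + 1)).filter fun i => S i ω = ℓ).card ≤ M := by
      simpa using Finset.card_le_univ ((A (m + 1)).filter fun i => S i ω = ℓ)
    rw [descr, add_mul, one_mul]
    split_ifs <;> omega

theorem descr_lt_iff {Ω : Type*} {M : ℕ} (S : Fin M → Ω → ℕ) (ℓ θ : ℕ)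
    (A : ℕ → Finset (Fin M)) (m : ℕ) (ω : Ω) :
    descr S ℓ θ A m ω < θ ↔
      ∑ k ∈ Finset.range m, ((A (k + 1)).filter fun i => S i ω = ℓ).card < θ := by
  have key : descr S ℓ θ A m ω =
        ∑ k ∈ Finset.range m, ((A (k + 1)).filter fun i => S i ω = ℓ).card ∨
      θ ≤ descr S ℓ θ A m ω ∧
        θ ≤ ∑ k ∈ Finset.range m, ((A (k + 1)).filter fun i => S i ω = ℓ).card := by
    induction m with
    | zero => exact Or.inl rfl
    | succ m ih =>
      rw [descr, Finset.sum_range_succ]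
      split_ifs <;> omega
  omega

/-- Lower tail bound for a sum of independent Bernoulli variables. -/
theorem measureReal_sum_bernoulli_le {Ω ι : Type*} [MeasurableSpace Ω] {μ : Measure Ω}
    [IsProbabilityMeasure μ] {Z : ι → Ω → ℝ} (hZ : ∀ i, Measurable (Z i))
    (hZ01 : ∀ i ω, Z i ω = 0 ∨ Z i ω = 1) (hindep : iIndepFun Z μ) (B : Finset ι) (x : ℝ) :
    μ.real {ω | ∑ i ∈ B, Z i ω ≤ x} ≤ Real.exp (x - (∑ i ∈ B, ∫ ω, Z i ω ∂μ) / 2) := by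
  have hint : ∀ i, Integrable (Z i) μ := fun i =>
    Integrable.of_bound (hZ i).aestronglyMeasurable 1
      (ae_of_all _ fun ω => by rcases hZ01 i ω with h | h <;> simp [h])
  have hmgf : ∀ i, mgf (Z i) μ (-1) ≤ Real.exp (-(∫ ω, Z i ω ∂μ) / 2) := by
    intro i
    calc mgf (Z i) μ (-1) ≤ ∫ ω, (1 - Z i ω / 2) ∂μ := by
          refine integral_mono_of_nonneg (ae_of_all _ fun ω => (Real.exp_pos _).le)
            ((integrable_const _).sub ((hint i).div_const 2)) (ae_of_all _ fun ω => ?_)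
          have := Real.exp_neg_one_lt_half
          rcases hZ01 i ω with h | h
          · simp [h]
          · simp only [h, mul_one]; linarith
      _ = 1 - (∫ ω, Z i ω ∂μ) / 2 := by
          rw [integral_sub (integrable_const _) ((hint i).div_const 2), integral_div]
          simp
      _ ≤ _ := by
          have := Real.add_one_le_exp (-(∫ ω, Z i ω ∂μ) / 2)
          linarith
  have hnn : ∀ i ω, 0 ≤ Z i ω := fun i ω => by rcases hZ01 i ω with h | h <;> simp [h]
  have hexp : Integrable (fun ω => Real.exp (-1 * (∑ i ∈ B, Z i) ω)) μ := by
    refine Integrable.of_bound ?_ 1 (ae_of_all _ fun ω => ?_)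
    · have : Measurable (∑ i ∈ B, Z i) := by
        simpa only [← Finset.sum_apply] using Finset.measurable_sum (B) fun i _ => hZ i
      exact (this.const_mul _).exp.aestronglyMeasurable
    · rw [Real.norm_eq_abs, abs_of_pos (Real.exp_pos _), Real.exp_le_one_iff, Finset.sum_apply]
      have := Finset.sum_nonneg fun i (_ : i ∈ B) => hnn i ω
      linarith
  have h := measure_le_le_exp_mul_mgf x (by norm_num : (-1 : ℝ) ≤ 0) hexp
  rw [hindep.mgf_sum hZ] at h
  simp only [Finset.sum_apply] at h
  refine h.trans ?_
  calc _ ≤ Real.exp (- -1 * x) * ∏ i ∈ B, Real.exp (-(∫ ω, Z i ω ∂μ) / 2) := by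
        gcongr with i _
        · exact fun i _ => mgf_nonneg
        · exact hmgf i
    _ = _ := by
        rw [← Real.exp_sum, ← Real.exp_add, ← Finset.sum_div, Finset.sum_neg_distrib]
        congr 1
        ring

/-- The mean cost of a sequence of groups, where group `m + 1` costs `b + a` times its number of
successes as long as the first `m` groups together have fewer than `θ` successes. -/
theorem integrable_and_integral_stopped_cost_le {Ω ι : Type*} [DecidableEq ι] [MeasurableSpace Ω]
    {μ : Measure Ω} [IsProbabilityMeasure μ] {Z : ι → Ω → ℝ} (hZ : ∀ i, Measurable (Z i))
    (hZ01 : ∀ i ω, Z i ω = 0 ∨ Z i ω = 1) (hindep : iIndepFun Z μ) (θ J : ℕ)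
    (A : ℕ → Finset ι) (hA : Pairwise (Function.onFun Disjoint A))
    (hub : ∀ m, ∑ i ∈ A m, ∫ ω, Z i ω ∂μ ≤ 2 * θ + 1)
    (hlb : ∀ m ∈ Finset.Ico 1 J, 2 * θ ≤ ∑ i ∈ A m, ∫ ω, Z i ω ∂μ)
    {a b : ℝ} (ha : 0 ≤ a) (hb : 0 ≤ b) :
    Integrable (fun ω => ∑ m ∈ Finset.range J,
        {ω | ∑ k ∈ Finset.range m, ∑ i ∈ A (k + 1), Z i ω < θ}.indicator
          (fun ω => b + a * ∑ i ∈ A (m + 1), Z i ω) ω) μ ∧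
    ∫ ω, ∑ m ∈ Finset.range J,
        {ω | ∑ k ∈ Finset.range m, ∑ i ∈ A (k + 1), Z i ω < θ}.indicator
          (fun ω => b + a * ∑ i ∈ A (m + 1), Z i ω) ω ∂μ ≤ 2 * (b + a * (2 * θ + 1)) := by
  have hint : ∀ i, Integrable (Z i) μ := fun i =>
    Integrable.of_bound (hZ i).aestronglyMeasurable 1
      (ae_of_all _ fun ω => by rcases hZ01 i ω with h | h <;> simp [h])
  set E : ℕ → Set Ω := fun m => {ω | ∑ k ∈ Finset.range m, ∑ i ∈ A (k + 1), Z i ω < θ}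
  have hE : ∀ m, MeasurableSet (E m) := fun m =>
    measurableSet_lt (Finset.measurable_sum _ fun k _ => Finset.measurable_sum _ fun i _ => hZ i)
      measurable_const
  set B : ℕ → Finset ι := fun m => (Finset.range m).biUnion fun k => A (k + 1)
  have hsumB (m : ℕ) (f : ι → ℝ) :
      ∑ i ∈ B m, f i = ∑ k ∈ Finset.range m, ∑ i ∈ A (k + 1), f i :=
    Finset.sum_biUnion fun k _ k' _ hk => hA (by simpa using hk)
  have hEB : ∀ m, E m = {ω | ∑ i ∈ B m, Z i ω < θ} := fun m => by
    simp only [hsumB]; rfl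
  have hcost : ∀ m, Integrable (fun ω => b + a * ∑ i ∈ A (m + 1), Z i ω) μ := fun m =>
    (integrable_const _).add ((integrable_finsetSum _ fun i _ => hint i).const_mul a)
  have hprod : ∀ m, ∀ i ∈ A (m + 1),
      ∫ ω, (E m).indicator (Z i) ω ∂μ = μ.real (E m) * ∫ ω, Z i ω ∂μ := by
    intro m i hi
    have hiB : i ∉ B m := by
      simp only [B, Finset.mem_biUnion, Finset.mem_range, not_exists, not_and]
      intro k hk hik
      exact Finset.disjoint_left.1 (hA (by omega : k + 1 ≠ m + 1)) hik hi
    have hφ : Measurable ((Set.Iio (θ : ℝ)).indicator (fun _ => (1 : ℝ))) :=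
      measurable_const.indicator measurableSet_Iio
    have hI := (hindep.indepFun_finsetSum_of_notMem hZ hiB).comp hφ measurable_id
    have hsum : Measurable (∑ j ∈ B m, Z j) := by
        simpa only [← Finset.sum_apply] using Finset.measurable_sum (B m) fun j _ => hZ j
    have h := hI.integral_fun_mul_eq_mul_integral (hφ.comp hsum).aestronglyMeasurable
      (hZ i).aestronglyMeasurable
    have hfun : ∀ ω, ((Set.Iio (θ : ℝ)).indicator (fun _ => (1 : ℝ)) ∘ ∑ j ∈ B m, Z j) ω =
        (E m).indicator 1 ω := by
      intro ω
      simp [hEB, Set.indicator_apply]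
    simp only [hfun] at h
    rw [integral_indicator_one (hE m)] at h
    simp only [Function.comp_apply, id] at h
    rw [← h]
    refine integral_congr_ae (ae_of_all _ fun ω => ?_)
    by_cases hω : ω ∈ E m <;> simp [hω]
  have hprob : ∀ m ∈ Finset.range J, μ.real (E m) ≤ (1 / 2) ^ m := by
    intro m hm
    rcases Nat.eq_zero_or_pos m with rfl | hm0
    · simp
    rcases Nat.eq_zero_or_pos θ with rfl | hθ
    · have : E m = ∅ := by
        ext ω
        have : 0 ≤ ∑ k ∈ Finset.range m, ∑ i ∈ A (k + 1), Z i ω :=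
          Finset.sum_nonneg fun k _ => Finset.sum_nonneg fun i _ => by
            rcases hZ01 i ω with h | h <;> simp [h]
        simpa [E] using this
      rw [this]
      simp
    have hsub : E m ⊆ {ω | ∑ i ∈ B m, Z i ω ≤ (θ : ℝ) - 1} := by
      intro ω hω
      rw [hEB] at hω
      choose! n hn using fun i => (show ∃ n : ℕ, Z i ω = n from by
        rcases hZ01 i ω with h | h
        · exact ⟨0, by simpa using h⟩
        · exact ⟨1, by simpa using h⟩)
      simp only [Set.mem_ofPred_eq, hn] at hω ⊢
      have h1 : ∑ i ∈ B m, n i + 1 ≤ θ := by exact_mod_cast hω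
      have h2 : (∑ i ∈ B m, (n i : ℝ)) + 1 ≤ θ := by exact_mod_cast h1
      linarith
    have hmean : (m : ℝ) * (2 * θ) ≤ ∑ i ∈ B m, ∫ ω, Z i ω ∂μ := by
      rw [hsumB]
      have := Finset.card_nsmul_le_sum (Finset.range m)
        (fun k => ∑ i ∈ A (k + 1), ∫ ω, Z i ω ∂μ) (2 * θ) (fun k hk => hlb _ (by
          simp only [Finset.mem_range, Finset.mem_Ico] at hk hm ⊢
          omega))
      simpa using this
    calc μ.real (E m) ≤ _ := measureReal_mono hsub
      _ ≤ _ := measureReal_sum_bernoulli_le hZ hZ01 hindep (B m) _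
      _ ≤ Real.exp (m * (-1)) := by
          rw [Real.exp_le_exp]
          have h1 : (1 : ℝ) ≤ m := by exact_mod_cast hm0
          have h2 : (1 : ℝ) ≤ θ := by exact_mod_cast hθ
          nlinarith [mul_nonneg (sub_nonneg.2 h1) (sub_nonneg.2 h2)]
      _ = Real.exp (-1) ^ m := Real.exp_nat_mul _ _
      _ ≤ _ := pow_le_pow_left₀ (Real.exp_pos _).le Real.exp_neg_one_lt_half.le m
  refine ⟨integrable_finsetSum _ fun m _ => (hcost m).indicator (hE m), ?_⟩
  have hc : 0 ≤ b + a * (2 * θ + 1) := by positivity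
  rw [integral_finsetSum _ fun m _ => (hcost m).indicator (hE m)]
  have hterm : ∀ m ∈ Finset.range J,
      ∫ ω, (E m).indicator (fun ω => b + a * ∑ i ∈ A (m + 1), Z i ω) ω ∂μ ≤
        (1 / 2) ^ m * (b + a * (2 * θ + 1)) := by
    intro m hm
    calc _ = μ.real (E m) * (b + a * ∑ i ∈ A (m + 1), ∫ ω, Z i ω ∂μ) := by
          rw [integral_indicator (hE m), integral_add (integrable_const _).integrableOn
            ((integrable_finsetSum _ fun i _ => hint i).const_mul a).integrableOn,
            integral_const_mul, integral_finsetSum _ fun i _ => (hint i).integrableOn]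
          have : ∀ i ∈ A (m + 1), ∫ ω in E m, Z i ω ∂μ = μ.real (E m) * ∫ ω, Z i ω ∂μ :=
            fun i hi => by rw [← hprod m i hi, integral_indicator (hE m)]
          rw [Finset.sum_congr rfl this, ← Finset.mul_sum]
          simp
          ring
      _ ≤ μ.real (E m) * (b + a * (2 * θ + 1)) := by
          gcongr
          exact hub _
      _ ≤ _ := by
          gcongr
          exact hprob m hm
  refine (Finset.sum_le_sum hterm).trans ?_
  rw [← Finset.sum_mul]
  gcongr
  exact sum_geometric_two_le J

theorem neg_logb_stoppedGeometric_descr {Ω : Type*} {M : ℕ} (S : Fin M → Ω → ℕ) (ℓ θ : ℕ)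
    (A : ℕ → Finset (Fin M)) {r : ℝ} (hr₀ : 0 < r) (hr₁ : r < 1) (m : ℕ) (ω : Ω) :
    0 < stoppedGeometric θ r (descr S ℓ θ A m ω) (descr S ℓ θ A (m + 1) ω) ∧
    -Real.logb 2 (stoppedGeometric θ r (descr S ℓ θ A m ω) (descr S ℓ θ A (m + 1) ω)) =
      {ω | ∑ k ∈ Finset.range m, ∑ i ∈ A (k + 1), (if S i ω = ℓ then (1 : ℝ) else 0) <
        θ}.indicator (fun ω => -Real.logb 2 (1 - r) + -Real.logb 2 r *
          ∑ i ∈ A (m + 1), (if S i ω = ℓ then (1 : ℝ) else 0)) ω := by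
  have hmem : descr S ℓ θ A m ω < θ ↔
      ω ∈ {ω | ∑ k ∈ Finset.range m, ∑ i ∈ A (k + 1), (if S i ω = ℓ then (1 : ℝ) else 0) < θ} := by
    rw [descr_lt_iff, Set.mem_ofPred_eq, ← Nat.cast_lt (α := ℝ)]
    simp
  rw [stoppedGeometric, descr]
  by_cases h : descr S ℓ θ A m ω < θ
  · rw [Set.indicator_of_mem (hmem.1 h)]
    have h1 : 0 < 1 - r := sub_pos.2 hr₁
    simp only [h, if_true, Nat.le_add_right, Nat.add_sub_cancel_left]
    refine ⟨by positivity, ?_⟩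
    rw [Real.logb_mul h1.ne' (by positivity), Real.logb_pow]
    simp
    ring
  · rw [Set.indicator_of_notMem (fun h' => h (hmem.2 h'))]
    simp [h]

/-- For every value `ℓ` some partition admits a code for its description of mean length
independent of the number of sources. -/
theorem exists_partition_codeLength_le {Ω : Type*} [MeasurableSpace Ω] (μ : Measure Ω)
    [IsProbabilityMeasure μ] (M : ℕ) (hM : 0 < M) (S : Fin M → Ω → ℕ)
    (hS : ∀ i, Measurable (S i)) (hindep : iIndepFun S μ) (ℓ θ : ℕ) :
    ∃ (J : ℕ) (A : ℕ → Finset (Fin M)) (g : ℕ → ℕ → ℝ), 0 < J ∧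
      (∀ m ∈ Finset.Icc 1 J, (A m).Nonempty) ∧
      (∀ m ∈ Finset.Icc 1 J, ∀ m' ∈ Finset.Icc 1 J, m ≠ m' → Disjoint (A m) (A m')) ∧
      (Finset.Icc 1 J).biUnion A = Finset.univ ∧
      (∀ u v, 0 ≤ g u v) ∧ (∀ K u, ∑ v ∈ Finset.range K, g u v ≤ 1) ∧
      (∀ ω, 0 < pathWeight g J 0 fun m => descr S ℓ θ A (m.1 + 1) ω) ∧
      Integrable (fun ω =>
        -Real.logb 2 (pathWeight g J 0 fun m => descr S ℓ θ A (m.1 + 1) ω)) μ ∧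
      ∫ ω, -Real.logb 2 (pathWeight g J 0 fun m => descr S ℓ θ A (m.1 + 1) ω) ∂μ ≤
        6 + 2 * Real.logb 2 (1 + (θ : ℝ)) := by
  set φ : ℕ → ℝ := fun n => if n = ℓ then 1 else 0
  have hφ : Measurable φ := measurable_from_top
  set Z : Fin M → Ω → ℝ := fun i ω => if S i ω = ℓ then 1 else 0
  have hZ : ∀ i, Measurable (Z i) := fun i => hφ.comp (hS i)
  have hZ01 : ∀ i ω, Z i ω = 0 ∨ Z i ω = 1 := fun i ω => by
    by_cases h : S i ω = ℓ <;> simp [Z, h]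
  have hZindep : iIndepFun Z μ := hindep.comp (fun _ => φ) fun _ => hφ
  have hp : ∀ i, ∫ ω, Z i ω ∂μ ≤ 1 := fun i => by
    calc ∫ ω, Z i ω ∂μ ≤ ∫ _, (1 : ℝ) ∂μ := by
          refine integral_mono_of_nonneg (ae_of_all _ fun ω => ?_) (integrable_const _)
            (ae_of_all _ fun ω => ?_) <;> rcases hZ01 i ω with h | h <;> simp [h]
      _ = 1 := by simp
  obtain ⟨J, c, hJ, hc, hne, hub, hlb⟩ := exists_balanced_grouping (fun i => ∫ ω, Z i ω ∂μ) hp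
    (2 * θ) (by positivity) Finset.univ ⟨⟨0, hM⟩, Finset.mem_univ _⟩
  set A : ℕ → Finset (Fin M) := fun m => Finset.univ.filter fun i => c i = m
  have hA : Pairwise (Function.onFun Disjoint A) := fun m m' h =>
    Finset.disjoint_filter.2 fun i _ h1 h2 => h (h1.symm.trans h2)
  set t : ℝ := 2 * θ + 1
  have ht : 0 < t := by positivity
  set r : ℝ := t / (t + 1)
  have hr₀ : 0 < r := by positivity
  have hr₁ : r < 1 := (div_lt_one (by positivity)).2 (by linarith)
  have hone : 1 - r = (t + 1)⁻¹ := by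
    simp only [r]
    field_simp
    ring
  have hlog2 : 0 < Real.log 2 := Real.log_pos one_lt_two
  have ha : 0 ≤ -Real.logb 2 r := neg_nonneg.2 (Real.logb_nonpos one_lt_two hr₀.le hr₁.le)
  have hb : -Real.logb 2 (1 - r) = 1 + Real.logb 2 (1 + (θ : ℝ)) := by
    have : t + 1 = 2 * (1 + (θ : ℝ)) := by simp only [t]; ring
    rw [hone, Real.logb_inv, neg_neg, this, Real.logb_mul two_ne_zero (by positivity),
      Real.logb_self_eq_one one_lt_two]
  have hb₀ : 0 ≤ -Real.logb 2 (1 - r) := by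
    rw [hb]
    have := Real.logb_nonneg one_lt_two (by simp : (1 : ℝ) ≤ 1 + θ)
    linarith
  have hat : -Real.logb 2 r * t ≤ 2 := by
    have h1 : -Real.log r ≤ 1 / t := by
      rw [← Real.log_inv]
      refine (Real.log_le_sub_one_of_pos (inv_pos.2 hr₀)).trans_eq ?_
      simp only [r]
      field_simp
      ring
    have h2 : -Real.log r * t ≤ 1 := by
      calc _ ≤ 1 / t * t := by gcongr
        _ = 1 := by field_simp
    rw [Real.logb, ← neg_div, div_mul_eq_mul_div, div_le_iff₀ hlog2]
    linarith [Real.log_two_gt_d9]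
  have hcode := fun m ω => neg_logb_stoppedGeometric_descr S ℓ θ A hr₀ hr₁ m ω
  have hpath : ∀ ω, pathWeight (stoppedGeometric θ r) J 0
      (fun m => descr S ℓ θ A (m.1 + 1) ω) = ∏ m ∈ Finset.range J,
        stoppedGeometric θ r (descr S ℓ θ A m ω) (descr S ℓ θ A (m + 1) ω) := fun ω =>
    pathWeight_eq_prod (stoppedGeometric θ r) J fun m => descr S ℓ θ A m ω
  obtain ⟨hint, hle⟩ := integrable_and_integral_stopped_cost_le hZ hZ01 hZindep θ J A hA hub hlb
    ha hb₀
  have hlog : ∀ ω, -Real.logb 2 (pathWeight (stoppedGeometric θ r) J 0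
      fun m => descr S ℓ θ A (m.1 + 1) ω) = ∑ m ∈ Finset.range J,
        {ω | ∑ k ∈ Finset.range m, ∑ i ∈ A (k + 1), Z i ω < θ}.indicator
          (fun ω => -Real.logb 2 (1 - r) + -Real.logb 2 r * ∑ i ∈ A (m + 1), Z i ω) ω := by
    intro ω
    rw [hpath, Real.logb_prod _ _ fun m _ => (hcode m ω).1.ne', ← Finset.sum_neg_distrib]
    exact Finset.sum_congr rfl fun m _ => (hcode m ω).2
  refine ⟨J, A, stoppedGeometric θ r, hJ, ?_, fun m _ m' _ h => hA h, ?_,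
    stoppedGeometric_nonneg θ hr₀.le hr₁.le, sum_stoppedGeometric_le_one θ hr₀.le hr₁, ?_, ?_, ?_⟩
  · intro m hm
    obtain ⟨i, hi, him⟩ := hne m hm
    exact ⟨i, Finset.mem_filter.2 ⟨hi, him⟩⟩
  · ext i
    simpa [A] using hc i (Finset.mem_univ i)
  · intro ω
    rw [hpath]
    exact Finset.prod_pos fun m _ => (hcode m ω).1
  · simpa only [hlog] using hint
  · simp only [hlog]
    refine hle.trans ?_
    linarith

/-- **Bound (eq:bounded_dsp), Section IV.** For independent sources `S₁, …, S_M` taking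
values in `{0, …, q-1}` and any threshold vector `θ₀, …, θ_{q-1}`, there exist partitions
(one for each value `ℓ`) such that the joint entropy of all descriptions of all clipped
frequencies is at most `12 q + (5/2) ∑_ℓ log₂(1 + θ_ℓ)`, independent of `M`. -/
theorem stmt14 {Ω : Type*} [MeasurableSpace Ω] (μ : Measure Ω) [IsProbabilityMeasure μ]
    (q M : ℕ) (hq : 2 ≤ q) (hM : 0 < M)
    (S : Fin M → Ω → ℕ) (hSmeas : ∀ i, Measurable (S i)) (hSval : ∀ i ω, S i ω < q)
    (hindep : iIndepFun S μ)
    (θ : Fin q → ℕ) :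
    ∃ (J : Fin q → ℕ) (A : Fin q → ℕ → Finset (Fin M)),
      (∀ ℓ, 0 < J ℓ) ∧
      (∀ ℓ, ∀ m ∈ Finset.Icc 1 (J ℓ), (A ℓ m).Nonempty) ∧
      (∀ ℓ, ∀ m ∈ Finset.Icc 1 (J ℓ), ∀ m' ∈ Finset.Icc 1 (J ℓ),
        m ≠ m' → Disjoint (A ℓ m) (A ℓ m')) ∧
      (∀ ℓ, (Finset.Icc 1 (J ℓ)).biUnion (A ℓ) = Finset.univ) ∧
      shannonEntropy μ
          (fun ω => fun (ℓ : Fin q) (m : Fin (J ℓ)) => descr S ℓ.1 (θ ℓ) (A ℓ) (m.1 + 1) ω)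
        ≤ 12 * q + (5 / 2) * ∑ ℓ : Fin q, Real.logb 2 (1 + (θ ℓ : ℝ)) := by
  choose J A g hJ hne hdisj hunion hg hsum hpos hint hle using fun ℓ : Fin q =>
    exists_partition_codeLength_le μ M hM S hSmeas hindep ℓ.1 (θ ℓ)
  refine ⟨J, A, hJ, hne, hdisj, hunion, ?_⟩
  set X : Ω → (ℓ : Fin q) → Fin (J ℓ) → ℕ :=
    fun ω ℓ m => descr S ℓ.1 (θ ℓ) (A ℓ) (m.1 + 1) ω
  have hXmeas : Measurable X := measurable_pi_lambda _ fun ℓ => measurable_pi_lambda _ fun m =>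
    measurable_descr hSmeas _ _ _ _
  have hF : ∀ ω, X ω ∈ Fintype.piFinset fun ℓ : Fin q =>
      Fintype.piFinset fun _ : Fin (J ℓ) => Finset.range (J ℓ * M + 1) := by
    intro ω
    simp only [Fintype.mem_piFinset, Finset.mem_range, Nat.lt_succ_iff]
    exact fun ℓ m => (descr_le_mul S ℓ.1 (θ ℓ) (A ℓ) (m.1 + 1) ω).trans
      (Nat.mul_le_mul_right M m.2)
  have hbound := shannonEntropy_le_integral_neg_logb μ X _ hF
    (fun a => hXmeas (measurableSet_singleton a))
    (fun x => ∏ ℓ, pathWeight (g ℓ) (J ℓ) 0 (x ℓ))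
    (fun x => Finset.prod_nonneg fun ℓ _ => pathWeight_nonneg (hg ℓ) _ _ _)
    (fun ω => Finset.prod_pos fun ℓ _ => hpos ℓ ω)
    (by
      rw [← Finset.prod_univ_sum (fun ℓ => Fintype.piFinset fun _ : Fin (J ℓ) =>
        Finset.range (J ℓ * M + 1)) fun ℓ f => pathWeight (g ℓ) (J ℓ) 0 f]
      exact Finset.prod_le_one
        (fun ℓ _ => Finset.sum_nonneg fun f _ => pathWeight_nonneg (hg ℓ) _ _ _)
        fun ℓ _ => sum_pathWeight_le_one (hg ℓ) _ (hsum ℓ _) _ _)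
  refine hbound.trans ?_
  have hlog : ∀ ω, -Real.logb 2 (∏ ℓ, pathWeight (g ℓ) (J ℓ) 0 (X ω ℓ)) =
      ∑ ℓ, -Real.logb 2 (pathWeight (g ℓ) (J ℓ) 0 (X ω ℓ)) := fun ω => by
    rw [Real.logb_prod _ _ fun ℓ _ => (hpos ℓ ω).ne', Finset.sum_neg_distrib]
  simp only [hlog]
  rw [integral_finsetSum _ fun ℓ _ => hint ℓ]
  refine (Finset.sum_le_sum fun ℓ _ => hle ℓ).trans ?_
  have hnonneg : 0 ≤ ∑ ℓ : Fin q, Real.logb 2 (1 + (θ ℓ : ℝ)) :=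
    Finset.sum_nonneg fun ℓ _ => Real.logb_nonneg one_lt_two (by simp)
  have hq₀ : (0 : ℝ) ≤ q := q.cast_nonneg
  rw [Finset.sum_add_distrib, ← Finset.mul_sum]
  simp only [Finset.sum_const, Finset.card_univ, Fintype.card_fin, nsmul_eq_mul]
  linarith
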